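/- Let ℓ ≥ 3 be an integer and let H be the cycle C_ℓ. If t = t(n) and b = b(n) satisfy b·√t/n → 0 as n → ∞ (i.e. b ≪ n/√t), then for every (t,b)-strategy B of Builder, the probability that the purchased graph B_t contains a subgraph isomorphic to H tends to 0 as n → ∞. -/

import Mathlib

open Filter

attribute [local instance] Classical.propDecidable

/-- The edges of the complete graph on `Fin n`: non-diagonal unordered pairs. -/
abbrev CEdge (n : ℕ) : Type := {e : Sym2 (Fin n) // ¬ e.IsDiag}

/-- The sample space: a uniformly random ordering of the edges of `K_n`,
encoded as a bijection from positions to edges. -/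
abbrev EdgeOrdering (n : ℕ) : Type := Fin (Fintype.card (CEdge n)) ≃ CEdge n

/-- The uniform probability of an event on a finite sample space. -/
noncomputable def uprob {α : Type} [Fintype α] (P : α → Prop) : ℝ :=
  ((Finset.univ.filter P).card : ℝ) / (Fintype.card α : ℝ)

/-- A (deterministic) strategy of Builder: given the current time `s`, the graph `B_{s-1}`
of previously purchased edges, and the observed edge `e_s`, decide whether to purchase it. -/
def Strategy (n : ℕ) : Type := ℕ → Finset (CEdge n) → CEdge n → Bool

/-- Builder's purchased graph `B_s` at time `s`, playing strategy `S` with budget `b`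
on the ordering `ω`.  An edge is purchased iff the strategy accepts it and the budget permits. -/
noncomputable def build (n b : ℕ) (S : Strategy n) (ω : EdgeOrdering n) : ℕ → Finset (CEdge n)
  | 0 => ∅
  | s + 1 =>
    let P := build n b S ω s
    if h : s < Fintype.card (CEdge n) then
      if S s P (ω ⟨s, h⟩) = true ∧ P.card < b then insert (ω ⟨s, h⟩) P else P
    else P

/-- The degree of the vertex `v` in the graph given by the edge set `P`. -/
noncomputable def edegree (n : ℕ) (P : Finset (CEdge n)) (v : Fin n) : ℕ :=
  (P.filter (fun e => v ∈ (e : Sym2 (Fin n)))).card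


/-- The edge set `P` contains a copy of the graph `H` (as a subgraph). -/
def containsCopy {k : ℕ} (H : SimpleGraph (Fin k)) (n : ℕ) (P : Finset (CEdge n)) : Prop :=
  ∃ f : Fin k → Fin n, Function.Injective f ∧
    ∀ u v : Fin k, H.Adj u v → ∃ e ∈ P, (e : Sym2 (Fin n)) = s(f u, f v)

/-- Every endpoint of `e` is covered by an edge of `P`. -/
def Trapped (n : ℕ) (P : Finset (CEdge n)) (e : CEdge n) : Prop :=
  ∀ v ∈ (e : Sym2 (Fin n)), ∃ e' ∈ P, v ∈ (e' : Sym2 (Fin n))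

theorem card_build_le (n b : ℕ) (S : Strategy n) (ω : EdgeOrdering n) (s : ℕ) :
    (build n b S ω s).card ≤ b := by
  induction s with
  | zero => simp [build]
  | succ s ih =>
    simp only [build]
    split_ifs with h h'
    · exact (Finset.card_insert_le _ _).trans h'.2
    · exact ih
    · exact ih

/-- The purchased graph at time `s` depends only on the first `s` edges. -/
theorem build_congr (n b : ℕ) (S : Strategy n) (ω ω' : EdgeOrdering n) (s : ℕ)
    (h : ∀ i, i.val < s → ω i = ω' i) : build n b S ω s = build n b S ω' s := by
  induction s with
  | zero => rfl
  | succ s ih =>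
    simp only [build]
    rw [ih fun i hi => h i (hi.trans s.lt_succ_self)]
    split_ifs with hs <;> simp_all

theorem card_trapped_le (n : ℕ) (P : Finset (CEdge n)) :
    (Finset.univ.filter (Trapped n P)).card ≤ 4 * P.card ^ 2 := by
  let V : Finset (Fin n) := P.biUnion fun e => (e : Sym2 (Fin n)).toFinset
  have hV : V.card ≤ P.card * 2 :=
    Finset.card_biUnion_le_card_mul _ _ _ fun e _ => by
      rw [Sym2.card_toFinset_of_not_isDiag _ e.2]
  have himage : (Finset.univ.filter (Trapped n P)).image Subtype.val ⊆
      (V ×ˢ V).image fun p => s(p.1, p.2) := by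
    intro x hx
    obtain ⟨e, he, rfl⟩ := Finset.mem_image.mp hx
    have he := (Finset.mem_filter.mp he).2
    have hmem : ∀ v ∈ (e : Sym2 (Fin n)), v ∈ V := fun v hv => by
      obtain ⟨e', he', hve'⟩ := he v hv
      exact Finset.mem_biUnion.mpr ⟨e', he', Sym2.mem_toFinset.mpr hve'⟩
    obtain ⟨⟨x, y⟩, hxy⟩ := Quot.exists_rep (e : Sym2 (Fin n))
    have hxy : s(x, y) = (e : Sym2 (Fin n)) := hxy
    rw [← hxy] at hmem ⊢
    exact Finset.mem_image.mpr ⟨(x, y), Finset.mem_product.mpr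
      ⟨hmem x (Sym2.mem_mk_left x y), hmem y (Sym2.mem_mk_right x y)⟩, rfl⟩
  calc (Finset.univ.filter (Trapped n P)).card
      = ((Finset.univ.filter (Trapped n P)).image Subtype.val).card :=
        (Finset.card_image_of_injective _ Subtype.val_injective).symm
    _ ≤ (V ×ˢ V).card := (Finset.card_le_card himage).trans Finset.card_image_le
    _ = V.card * V.card := Finset.card_product _ _
    _ ≤ (P.card * 2) * (P.card * 2) := Nat.mul_le_mul hV hV
    _ = 4 * P.card ^ 2 := by ring

/-- The edge arriving at position `s` is trapped by the graph purchased before it. -/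
def HitsTrap (n b : ℕ) (S : Strategy n) (s : ℕ) (ω : EdgeOrdering n) : Prop :=
  ∃ h : s < Fintype.card (CEdge n), Trapped n (build n b S ω s) (ω ⟨s, h⟩)

theorem card_hitsTrap_mul_le (n b : ℕ) (S : Strategy n) (s : ℕ) :
    (Fintype.card (CEdge n) - s) * (Finset.univ.filter (HitsTrap n b S s)).card ≤
      4 * b ^ 2 * Fintype.card (EdgeOrdering n) := by
  by_cases hs : s < Fintype.card (CEdge n)
  swap
  · rw [Nat.sub_eq_zero_of_le (not_lt.mp hs), zero_mul]
    exact Nat.zero_le _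
  let s' : Fin (Fintype.card (CEdge n)) := ⟨s, hs⟩
  let R : EdgeOrdering n → Fin (Fintype.card (CEdge n)) → Prop :=
    fun ω j => Trapped n (build n b S ω s) (ω j)
  have hfix : ∀ j ∈ Finset.Ici s',
      (Finset.univ.filter (HitsTrap n b S s)).card = (Finset.univ.filter (R · j)).card := by
    intro j hj
    have hbuild : ∀ ω : EdgeOrdering n,
        build n b S ((Equiv.swap s' j).trans ω) s = build n b S ω s := fun ω =>
      build_congr _ _ _ _ _ _ fun i hi => by
        have hi' : i < s' := hi
        rw [Equiv.trans_apply, Equiv.swap_apply_of_ne_of_ne hi'.ne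
          (hi'.trans_le (Finset.mem_Ici.mp hj)).ne]
    have hinv : ∀ ω : EdgeOrdering n,
        (Equiv.swap s' j).trans ((Equiv.swap s' j).trans ω) = ω := fun ω => by
      ext i; simp
    refine Finset.card_bij' (fun ω _ => (Equiv.swap s' j).trans ω)
      (fun ω _ => (Equiv.swap s' j).trans ω) ?_ ?_ (fun ω _ => hinv ω) (fun ω _ => hinv ω)
    · intro ω hω
      obtain ⟨_, hω⟩ := (Finset.mem_filter.mp hω).2
      refine Finset.mem_filter.mpr ⟨Finset.mem_univ _, ?_⟩
      simp only [R, hbuild, Equiv.trans_apply, Equiv.swap_apply_right]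
      exact hω
    · intro ω hω
      have hω := (Finset.mem_filter.mp hω).2
      refine Finset.mem_filter.mpr ⟨Finset.mem_univ _, hs, ?_⟩
      change Trapped n _ ((Equiv.swap s' j).trans ω s')
      rw [hbuild, Equiv.trans_apply, Equiv.swap_apply_left]
      exact hω
  have hrow : ∀ ω : EdgeOrdering n, ((Finset.Ici s').filter (R ω)).card ≤ 4 * b ^ 2 := by
    intro ω
    calc ((Finset.Ici s').filter (R ω)).card
        ≤ (Finset.univ.filter (Trapped n (build n b S ω s))).card :=
          Finset.card_le_card_of_injOn ω (fun j hj => by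
            simpa using (Finset.mem_filter.mp hj).2) ω.injective.injOn
      _ ≤ 4 * (build n b S ω s).card ^ 2 := card_trapped_le _ _
      _ ≤ 4 * b ^ 2 := by gcongr; exact card_build_le _ _ _ _ _
  calc (Fintype.card (CEdge n) - s) * (Finset.univ.filter (HitsTrap n b S s)).card
      = ∑ j ∈ Finset.Ici s', (Finset.univ.filter (HitsTrap n b S s)).card := by
        simp [s']
    _ = ∑ j ∈ Finset.Ici s', (Finset.univ.filter (R · j)).card := Finset.sum_congr rfl hfix
    _ = ∑ ω : EdgeOrdering n, ((Finset.Ici s').filter (R ω)).card :=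
        Finset.sum_card_bipartiteAbove_eq_sum_card_bipartiteBelow (fun j ω => R ω j)
    _ ≤ ∑ _ω : EdgeOrdering n, 4 * b ^ 2 := Finset.sum_le_sum fun ω _ => hrow ω
    _ = 4 * b ^ 2 * Fintype.card (EdgeOrdering n) := by
        rw [Finset.sum_const, Finset.card_univ, smul_eq_mul, mul_comm]

theorem uprob_hitsTrap_le (n b : ℕ) (S : Strategy n) (s : ℕ) :
    uprob (HitsTrap n b S s) ≤ 4 * (b : ℝ) ^ 2 / ((Fintype.card (CEdge n) - s : ℕ) : ℝ) := by
  by_cases hs : s < Fintype.card (CEdge n)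
  · have hpos : (0 : ℝ) < ((Fintype.card (CEdge n) - s : ℕ) : ℝ) := by
      exact_mod_cast Nat.sub_pos_of_lt hs
    have hcard : (0 : ℝ) < Fintype.card (EdgeOrdering n) := by
      have : Nonempty (EdgeOrdering n) := ⟨(Fintype.equivFin _).symm⟩
      exact_mod_cast Fintype.card_pos
    rw [uprob, div_le_div_iff₀ hcard hpos, mul_comm]
    exact_mod_cast card_hitsTrap_mul_le n b S s
  · have : ∀ ω, ¬ HitsTrap n b S s ω := fun ω h => hs h.1
    simp only [uprob, this, Finset.filter_false, Finset.card_empty, Nat.cast_zero, zero_div]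
    positivity

theorem cycleGraph_exists_adj_ne {ℓ : ℕ} (hℓ : 3 ≤ ℓ) (u v : Fin ℓ) :
    ∃ w, (SimpleGraph.cycleGraph ℓ).Adj u w ∧ w ≠ v := by
  obtain ⟨k, rfl⟩ := Nat.exists_eq_add_of_le' hℓ
  have hdeg : 1 < ((SimpleGraph.cycleGraph (k + 3)).neighborFinset u).card := by
    rw [SimpleGraph.card_neighborFinset_eq_degree, SimpleGraph.cycleGraph_degree_three_le]
    norm_num
  obtain ⟨w, hw, hwv⟩ := Finset.exists_mem_ne hdeg v
  exact ⟨w, (SimpleGraph.mem_neighborFinset _ _ _).mp hw, hwv⟩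

/-- An edge completing a copy of a graph of minimum degree at least two is trapped. -/
theorem containsCopy_insert {k : ℕ} {H : SimpleGraph (Fin k)}
    (hH : ∀ u v, ∃ w, H.Adj u w ∧ w ≠ v) {n : ℕ} {P : Finset (CEdge n)} {e : CEdge n}
    (h : containsCopy H n (insert e P)) : containsCopy H n P ∨ Trapped n P e := by
  obtain ⟨f, hf, hcopy⟩ := h
  refine or_iff_not_imp_left.mpr fun hP => ?_
  have hcover : ∀ u v, (e : Sym2 (Fin n)) = s(f u, f v) →
      ∃ e' ∈ P, f u ∈ (e' : Sym2 (Fin n)) := by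
    intro u v he
    obtain ⟨w, huw, hwv⟩ := hH u v
    obtain ⟨e', he', heq⟩ := hcopy u w huw
    rcases Finset.mem_insert.mp he' with rfl | he'
    · rw [he, Sym2.congr_right] at heq
      exact absurd (hf heq).symm hwv
    · exact ⟨e', he', heq ▸ Sym2.mem_mk_left _ _⟩
  obtain ⟨u, v, he⟩ : ∃ u v, (e : Sym2 (Fin n)) = s(f u, f v) := by
    by_contra! hne
    refine hP ⟨f, hf, fun u v huv => ?_⟩
    obtain ⟨e', he', heq⟩ := hcopy u v huv
    rcases Finset.mem_insert.mp he' with rfl | he'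
    · exact absurd heq (hne u v)
    · exact ⟨e', he', heq⟩
  intro x hx
  rw [he, Sym2.mem_iff] at hx
  rcases hx with rfl | rfl
  · exact hcover u v he
  · exact hcover v u (he.trans Sym2.eq_swap)

theorem exists_hitsTrap_of_containsCopy {k : ℕ} {H : SimpleGraph (Fin k)} (hk : 0 < k)
    (hH : ∀ u v, ∃ w, H.Adj u w ∧ w ≠ v) (n b : ℕ) (S : Strategy n) (ω : EdgeOrdering n)
    (t : ℕ) (h : containsCopy H n (build n b S ω t)) : ∃ s < t, HitsTrap n b S s ω := by
  induction t with
  | zero =>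
    obtain ⟨f, _, hcopy⟩ := h
    obtain ⟨w, hw, _⟩ := hH ⟨0, hk⟩ ⟨0, hk⟩
    obtain ⟨e, he, _⟩ := hcopy _ _ hw
    simp [build] at he
  | succ t ih =>
    have hstep : containsCopy H n (build n b S ω t) ∨ HitsTrap n b S t ω := by
      simp only [build] at h
      split_ifs at h with ht hbuy
      · exact (containsCopy_insert hH h).imp_right fun h => ⟨ht, h⟩
      · exact Or.inl h
      · exact Or.inl h
    rcases hstep with h | h
    · obtain ⟨s, hs, h⟩ := ih h
      exact ⟨s, hs.trans t.lt_succ_self, h⟩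
    · exact ⟨t, t.lt_succ_self, h⟩

theorem uprob_nonneg {α : Type} [Fintype α] (P : α → Prop) : 0 ≤ uprob P := by
  unfold uprob; positivity

theorem uprob_le_sum {α : Type} [Fintype α] (P : α → Prop) (Q : ℕ → α → Prop) (t : ℕ)
    (h : ∀ ω, P ω → ∃ s < t, Q s ω) : uprob P ≤ ∑ s ∈ Finset.range t, uprob (Q s) := by
  simp only [uprob]
  rw [← Finset.sum_div]
  gcongr
  have hsub : Finset.univ.filter P ⊆
      (Finset.range t).biUnion fun s => Finset.univ.filter (Q s) := by
    intro ω hω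
    obtain ⟨s, hs, hQ⟩ := h ω (Finset.mem_filter.mp hω).2
    exact Finset.mem_biUnion.mpr
      ⟨s, Finset.mem_range.mpr hs, Finset.mem_filter.mpr ⟨Finset.mem_univ _, hQ⟩⟩
  exact_mod_cast (Finset.card_le_card hsub).trans Finset.card_biUnion_le

theorem uprob_containsCopy_cycleGraph_le {ℓ : ℕ} (hℓ : 3 ≤ ℓ) (n b t : ℕ) (S : Strategy n) :
    uprob (fun ω : EdgeOrdering n =>
        containsCopy (SimpleGraph.cycleGraph ℓ) n (build n b S ω t)) ≤
      ∑ s ∈ Finset.range t, 4 * (b : ℝ) ^ 2 / ((Fintype.card (CEdge n) - s : ℕ) : ℝ) :=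
  (uprob_le_sum _ (HitsTrap n b S) t fun ω =>
    exists_hitsTrap_of_containsCopy (by omega) (cycleGraph_exists_adj_ne hℓ) n b S ω t).trans
    (Finset.sum_le_sum fun s _ => uprob_hitsTrap_le n b S s)

theorem sum_div_card_sub_le {n b t : ℕ} (hn : 2 ≤ n)
    (hx : (b : ℝ) * Real.sqrt t / n < 1 / 3) :
    ∑ s ∈ Finset.range t, 4 * (b : ℝ) ^ 2 / ((Fintype.card (CEdge n) - s : ℕ) : ℝ) ≤
      32 * ((b : ℝ) * Real.sqrt t / n) ^ 2 := by
  have hn' : (2 : ℝ) ≤ n := by exact_mod_cast hn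
  have hsq : ((b : ℝ) * Real.sqrt t / n) ^ 2 = (b : ℝ) ^ 2 * t / n ^ 2 := by
    rw [div_pow, mul_pow, Real.sq_sqrt (Nat.cast_nonneg t)]
  rw [hsq]
  rcases Nat.eq_zero_or_pos b with rfl | hb
  · simp
  have hb' : (1 : ℝ) ≤ b := by exact_mod_cast hb
  have ht : 8 * (t : ℝ) ≤ n ^ 2 := by
    have h9 : (b : ℝ) ^ 2 * t / n ^ 2 ≤ (1 / 3) ^ 2 := by
      rw [← hsq]
      exact pow_le_pow_left₀ (by positivity) hx.le 2
    rw [div_le_iff₀ (by positivity)] at h9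
    have : (t : ℝ) ≤ (b : ℝ) ^ 2 * t :=
      le_mul_of_one_le_left (Nat.cast_nonneg t) (one_le_pow₀ hb')
    nlinarith
  have hcard : (Fintype.card (CEdge n) : ℝ) = n * (n - 1) / 2 := by
    rw [Sym2.card_subtype_not_diag, Fintype.card_fin, Nat.cast_choose_two]
  have hterm : ∀ s ∈ Finset.range t,
      4 * (b : ℝ) ^ 2 / ((Fintype.card (CEdge n) - s : ℕ) : ℝ) ≤ 32 * (b : ℝ) ^ 2 / n ^ 2 := by
    intro s hs
    have hst : (s : ℝ) ≤ t := by exact_mod_cast (Finset.mem_range.mp hs).le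
    have hden : (n : ℝ) ^ 2 / 8 ≤ ((Fintype.card (CEdge n) - s : ℕ) : ℝ) := by
      have : (Fintype.card (CEdge n) : ℝ) - s ≤ ((Fintype.card (CEdge n) - s : ℕ) : ℝ) := by
        rw [sub_le_iff_le_add]
        exact_mod_cast le_tsub_add
      nlinarith
    calc 4 * (b : ℝ) ^ 2 / ((Fintype.card (CEdge n) - s : ℕ) : ℝ)
        ≤ 4 * (b : ℝ) ^ 2 / (n ^ 2 / 8) := by gcongr
      _ = 32 * (b : ℝ) ^ 2 / n ^ 2 := by field_simp; norm_num
  calc _ ≤ ∑ _s ∈ Finset.range t, 32 * (b : ℝ) ^ 2 / n ^ 2 := Finset.sum_le_sum hterm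
    _ = 32 * ((b : ℝ) ^ 2 * t / n ^ 2) := by
      rw [Finset.sum_const, Finset.card_range, nsmul_eq_mul]; ring

/-- Cycles, universal lower bound: if `b ≪ n/√t` (i.e. `b √t / n → 0`), then every
`(t,b)`-strategy fails, with high probability, to build a copy of the cycle `C_ℓ`. -/
theorem stmt8 (ℓ : ℕ) (hℓ : 3 ≤ ℓ) (t b : ℕ → ℕ)
    (hb : Tendsto (fun n : ℕ => (b n : ℝ) * Real.sqrt (t n) / (n : ℝ)) atTop (nhds 0)) :
    ∀ S : (n : ℕ) → Strategy n,
      Tendsto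
        (fun n => uprob (fun ω : EdgeOrdering n =>
          containsCopy (SimpleGraph.cycleGraph ℓ) n (build n (b n) (S n) ω (t n))))
        atTop (nhds 0) := by
  intro S
  have hlim : Tendsto (fun n : ℕ => 32 * ((b n : ℝ) * Real.sqrt (t n) / (n : ℝ)) ^ 2)
      atTop (nhds 0) := by
    simpa using (hb.pow 2).const_mul 32
  refine tendsto_of_tendsto_of_tendsto_of_le_of_le' tendsto_const_nhds hlim
    (Eventually.of_forall fun n => uprob_nonneg _) ?_
  filter_upwards [eventually_ge_atTop 2, hb.eventually_lt_const (by norm_num : (0 : ℝ) < 1 / 3)]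
    with n hn hx
  exact (uprob_containsCopy_cycleGraph_le hℓ n (b n) (t n) (S n)).trans
    (sum_div_card_sub_le hn hx)
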